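/- Every hitomezashi loop has odd width and odd height. -/

import Mathlib

/-- A stitch is a unit segment of the grid: `vert i j` is the vertical segment from
`(i,j)` to `(i,j+1)`; `horiz i j` is the horizontal segment from `(i,j)` to `(i+1,j)`. -/
inductive Stitch : Type
  | vert : ℤ → ℤ → Stitch
  | horiz : ℤ → ℤ → Stitch
  deriving DecidableEq

/-- Membership of a stitch in the hitomezashi pattern with labels `ε` (vertical lines)
and `η` (horizontal lines). -/
def Stitch.InPattern (ε η : ℤ → ZMod 2) : Stitch → Prop
  | .vert i j => (j : ZMod 2) = ε i
  | .horiz i j => (i : ZMod 2) = η j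

/-- The stitch as a subset of the plane. -/
def Stitch.seg : Stitch → Set (ℝ × ℝ)
  | .vert i j => segment ℝ ((i : ℝ), (j : ℝ)) ((i : ℝ), (j : ℝ) + 1)
  | .horiz i j => segment ℝ ((i : ℝ), (j : ℝ)) ((i : ℝ) + 1, (j : ℝ))

/-- The union of the segments of a set of stitches. -/
def curveOf (S : Set Stitch) : Set (ℝ × ℝ) := ⋃ s ∈ S, s.seg

/-- `C` is a simple closed curve: it is homeomorphic to a circle. -/
def IsCircle (C : Set (ℝ × ℝ)) : Prop :=
  Nonempty (C ≃ₜ Metric.sphere (0 : ℝ × ℝ) 1)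

/-- The interior of a closed curve `C`: the union of the bounded connected
components of its complement. -/
def intOf (C : Set (ℝ × ℝ)) : Set (ℝ × ℝ) :=
  {p | p ∉ C ∧ Bornology.IsBounded (connectedComponentIn Cᶜ p)}

/-- The exterior of a closed curve `C`: the union of the unbounded connected
components of its complement. -/
def extOf (C : Set (ℝ × ℝ)) : Set (ℝ × ℝ) :=
  {p | p ∉ C ∧ ¬ Bornology.IsBounded (connectedComponentIn Cᶜ p)}

/-- The open unit cell with southwest corner `(i,j)`. -/
def cell (i j : ℤ) : Set (ℝ × ℝ) :=
  Set.Ioo (i : ℝ) ((i : ℝ) + 1) ×ˢ Set.Ioo (j : ℝ) ((j : ℝ) + 1)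

/-- A hitomezashi loop in the pattern with labels `ε`, `η`: a (finite) set of stitches
of the pattern whose union is a simple closed curve. -/
structure HLoop (ε η : ℤ → ZMod 2) where
  stitches : Finset Stitch
  inPattern : ∀ s ∈ stitches, s.InPattern ε η
  isCircle : IsCircle (curveOf ↑stitches)

/-- The width of a loop: difference between maximal and minimal x-coordinates of its points. -/
noncomputable def loopWidth {ε η : ℤ → ZMod 2} (L : HLoop ε η) : ℝ :=
  sSup (Prod.fst '' curveOf ↑L.stitches) - sInf (Prod.fst '' curveOf ↑L.stitches)

/-- The height of a loop: difference between maximal and minimal y-coordinates of its points. -/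
noncomputable def loopHeight {ε η : ℤ → ZMod 2} (L : HLoop ε η) : ℝ :=
  sSup (Prod.snd '' curveOf ↑L.stitches) - sInf (Prod.snd '' curveOf ↑L.stitches)

/-- A unit sphere with one point removed is preconnected. -/
theorem isPreconnected_unit_sphere_diff_singleton {E : Type*} [NormedAddCommGroup E]
    [NormedSpace ℝ E] {p : E} (hp : p ∈ Metric.sphere (0 : E) 1) :
    IsPreconnected (Metric.sphere (0 : E) 1 \ {p}) := by
  have hp1 : ‖p‖ = 1 := by simpa using hp
  have hp0 : p ≠ 0 := by
    rintro rfl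
    simp at hp1
  set U : Set E := {x | ∀ t : ℝ, 0 ≤ t → x ≠ t • p} with hU
  have hstar : StarConvex ℝ (-p) U := by
    intro x hx a b ha hb hab t ht h
    rcases hb.eq_or_lt with rfl | hb
    · have ha1 : a = 1 := by linarith
      subst ha1
      have h0 : (1 + t) • p = 0 := by
        rw [add_smul, ← h]
        simp
      rcases smul_eq_zero.1 h0 with h0 | h0
      · linarith
      · exact hp0 h0
    · refine hx ((a + t) / b) (by positivity) ?_
      have hbx : b • x = (a + t) • p := by
        rw [add_smul, ← h]
        simp
      rw [div_eq_inv_mul, mul_smul, ← hbx, smul_smul, inv_mul_cancel₀ hb.ne', one_smul]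
  have hneg : -p ∈ U := by
    intro t ht h
    have h0 : (1 + t) • p = 0 := by
      rw [add_smul, ← h]
      simp
    rcases smul_eq_zero.1 h0 with h0 | h0
    · linarith
    · exact hp0 h0
  have hU0 : ∀ x ∈ U, x ≠ 0 := fun x hx h => hx 0 le_rfl (by simpa using h)
  have hconn : IsPreconnected U := (hstar.isPathConnected hneg).isConnected.isPreconnected
  have himg : (fun x : E => ‖x‖⁻¹ • x) '' U = Metric.sphere (0 : E) 1 \ {p} := by
    ext y
    constructor
    · rintro ⟨x, hx, rfl⟩
      have hx0 : ‖x‖ ≠ 0 := norm_ne_zero_iff.2 (hU0 x hx)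
      refine ⟨by simp [norm_smul, hx0], fun h => hx ‖x‖ (norm_nonneg x) ?_⟩
      rw [← (h : ‖x‖⁻¹ • x = p), smul_smul, mul_inv_cancel₀ hx0, one_smul]
    · rintro ⟨hy, hyp⟩
      have hy1 : ‖y‖ = 1 := by simpa using hy
      refine ⟨y, fun t ht h => hyp ?_, by simp [hy1]⟩
      have : t = 1 := by
        have := congrArg norm h
        rwa [norm_smul, hp1, hy1, mul_one, Real.norm_of_nonneg ht, eq_comm] at this
      simpa [this] using h
  rw [← himg]
  refine hconn.image _ (ContinuousOn.smul (ContinuousOn.inv₀ continuousOn_id.norm ?_)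
    continuousOn_id)
  exact fun x hx => norm_ne_zero_iff.2 (hU0 x hx)

namespace IsCircle

variable {C : Set (ℝ × ℝ)}

theorem isPreconnected (hC : IsCircle C) : IsPreconnected C := by
  obtain ⟨e⟩ := hC
  have hrank : 1 < Module.rank ℝ (ℝ × ℝ) := by
    rw [rank_prod', Module.rank_self, one_add_one_eq_two]
    exact Cardinal.one_lt_two
  have : PreconnectedSpace (Metric.sphere (0 : ℝ × ℝ) 1) :=
    isPreconnected_iff_preconnectedSpace.1 (isPreconnected_sphere hrank 0 1)
  have : PreconnectedSpace C := e.symm.surjective.denseRange.preconnectedSpace e.symm.continuous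
  exact isPreconnected_iff_preconnectedSpace.2 this

theorem nonempty (hC : IsCircle C) : C.Nonempty := by
  obtain ⟨e⟩ := hC
  exact ⟨_, (e.symm ⟨(1, 0), by simp⟩).2⟩

theorem isPreconnected_diff_singleton (hC : IsCircle C) {q : ℝ × ℝ} (hq : q ∈ C) :
    IsPreconnected (C \ {q}) := by
  obtain ⟨e⟩ := hC
  have h := isPreconnected_unit_sphere_diff_singleton (e ⟨q, hq⟩).2
  have h' : IsPreconnected {z : Metric.sphere (0 : ℝ × ℝ) 1 | z ≠ e ⟨q, hq⟩} := by
    rw [← Topology.IsInducing.subtypeVal.isPreconnected_image]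
    have hdiff : (Subtype.val '' {z : Metric.sphere (0 : ℝ × ℝ) 1 | z ≠ e ⟨q, hq⟩}) =
        Metric.sphere (0 : ℝ × ℝ) 1 \ {(e ⟨q, hq⟩ : ℝ × ℝ)} := by
      apply Set.Subset.antisymm
      · rintro _ ⟨w, hw, rfl⟩
        exact ⟨w.2, fun h => hw (Subtype.ext h)⟩
      · intro z hz
        exact ⟨⟨z, hz.1⟩, fun h => hz.2 (congrArg Subtype.val h), rfl⟩
    rwa [← hdiff] at h
  have himg := h'.image (fun z => (e.symm z : ℝ × ℝ)) (by fun_prop)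
  convert himg using 1
  ext z
  constructor
  · rintro ⟨hz, hzq⟩
    exact ⟨e ⟨z, hz⟩, fun h => hzq (by simpa using h), by simp⟩
  · rintro ⟨w, hw, rfl⟩
    refine ⟨(e.symm w).2, fun h => hw ?_⟩
    rw [← e.apply_symm_apply w]
    exact congrArg e (Subtype.ext h)

/-- A level strictly between two values of a continuous function on a simple closed curve
is attained at two distinct points at least. -/
theorem exists_ne_eq_level (hC : IsCircle C) {f : ℝ × ℝ → ℝ} (hf : Continuous f)
    {p₁ p₂ : ℝ × ℝ} (h₁ : p₁ ∈ C) (h₂ : p₂ ∈ C) {t : ℝ} (ht₁ : f p₁ < t) (ht₂ : t < f p₂) :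
    ∃ q₁ ∈ C, ∃ q₂ ∈ C, q₁ ≠ q₂ ∧ f q₁ = t ∧ f q₂ = t := by
  obtain ⟨q₁, hq₁, hfq₁⟩ :=
    hC.isPreconnected.intermediate_value h₁ h₂ hf.continuousOn ⟨ht₁.le, ht₂.le⟩
  have hne₁ : p₁ ≠ q₁ := by
    rintro rfl
    exact ht₁.ne hfq₁
  have hne₂ : p₂ ≠ q₁ := by
    rintro rfl
    exact ht₂.ne' hfq₁
  obtain ⟨q₂, hq₂, hfq₂⟩ := (hC.isPreconnected_diff_singleton hq₁).intermediate_value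
    ⟨h₁, hne₁⟩ ⟨h₂, hne₂⟩ hf.continuousOn ⟨ht₁.le, ht₂.le⟩
  exact ⟨q₁, hq₁, q₂, hq₂.1, fun h => hq₂.2 h.symm, hfq₁, hfq₂⟩

end IsCircle

namespace Stitch

theorem mem_seg_vert {i j : ℤ} {p : ℝ × ℝ} :
    p ∈ (vert i j).seg ↔ p.1 = i ∧ (j : ℝ) ≤ p.2 ∧ p.2 ≤ j + 1 := by
  obtain ⟨x, y⟩ := p
  rw [seg, ← Prod.image_mk_segment_right, segment_eq_Icc (by linarith)]
  simp only [Set.mem_image, Set.mem_Icc, Prod.mk.injEq]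
  grind

theorem mem_seg_horiz {i j : ℤ} {p : ℝ × ℝ} :
    p ∈ (horiz i j).seg ↔ p.2 = j ∧ (i : ℝ) ≤ p.1 ∧ p.1 ≤ i + 1 := by
  obtain ⟨x, y⟩ := p
  rw [seg, ← Prod.image_mk_segment_left, segment_eq_Icc (by linarith)]
  simp only [Set.mem_image, Set.mem_Icc, Prod.mk.injEq]
  grind

theorem isClosed_seg (s : Stitch) : IsClosed s.seg := by
  cases s with
  | vert i j =>
    simp only [seg, ← Prod.image_mk_segment_right, segment_eq_Icc
      (show (j : ℝ) ≤ j + 1 by linarith)]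
    exact (isCompact_Icc.image (by fun_prop)).isClosed
  | horiz i j =>
    simp only [seg, ← Prod.image_mk_segment_left, segment_eq_Icc
      (show (i : ℝ) ≤ i + 1 by linarith)]
    exact (isCompact_Icc.image (by fun_prop)).isClosed

/-- The level of (the midpoint of) a stitch for the function `2 (X(x) - Y(y))`, where the
functions `X` and `Y` take the values `X k` and `Y k` at `k - 1/2` and are interpolated
linearly. -/
def level (X Y : ℤ → ℤ) : Stitch → ℤ
  | vert i j => X i + X (i + 1) - 2 * Y (j + 1)
  | horiz i j => 2 * X (i + 1) - (Y j + Y (j + 1))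

/-- Orient the vertical stitches of a pattern from the odd vertices to the even ones and the
horizontal stitches from the even vertices to the odd ones. If the steps of `X` and `Y` are the
resulting directions of the stitches on each line, then intersecting stitches have the same
level. -/
theorem level_eq_of_mem_seg {ε η X Y : ℤ → ℤ}
    (hX : ∀ i, X (i + 1) = X i + if Odd (i + ε i) then 1 else -1)
    (hY : ∀ j, Y (j + 1) = Y j + if Even (j + η j) then 1 else -1)
    {s t : Stitch} (hs : s.InPattern (fun i => ε i) (fun j => η j))
    (ht : t.InPattern (fun i => ε i) (fun j => η j)) {p : ℝ × ℝ}
    (hps : p ∈ s.seg) (hpt : p ∈ t.seg) : s.level X Y = t.level X Y := by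
  have cross : ∀ i j i' j' : ℤ, (vert i j).InPattern (fun i => ε i) (fun j => η j) →
      (horiz i' j').InPattern (fun i => ε i) (fun j => η j) → p ∈ (vert i j).seg →
      p ∈ (horiz i' j').seg → (vert i j).level X Y = (horiz i' j').level X Y := by
    intro i j i' j' hs ht hps hpt
    simp only [mem_seg_vert, mem_seg_horiz] at hps hpt
    simp only [InPattern, ZMod.intCast_eq_intCast_iff, Int.ModEq] at hs ht
    obtain ⟨hp1, h1, h2⟩ := hps
    obtain ⟨hp2, h3, h4⟩ := hpt
    rw [hp2] at h1 h2
    rw [hp1] at h3 h4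
    norm_cast at h1 h2 h3 h4
    have hi : i = i' ∨ i = i' + 1 := by omega
    have hj : j' = j ∨ j' = j + 1 := by omega
    have hXi := hX i
    have hYj := hY j'
    simp only [level]
    simp only [Int.odd_iff, Int.even_iff] at hXi hYj
    rcases hi with rfl | rfl <;> rcases hj with rfl | rfl <;>
      split_ifs at hXi hYj <;> omega
  cases s with
  | vert i j =>
    cases t with
    | vert i' j' =>
      simp only [mem_seg_vert] at hps hpt
      simp only [InPattern, ZMod.intCast_eq_intCast_iff, Int.ModEq] at hs ht
      have hi : i = i' := by exact_mod_cast hps.1.symm.trans hpt.1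
      have h1 : (j : ℝ) ≤ j' + 1 := hps.2.1.trans hpt.2.2
      have h2 : (j' : ℝ) ≤ j + 1 := hpt.2.1.trans hps.2.2
      norm_cast at h1 h2
      subst hi
      rw [show j = j' by omega]
    | horiz i' j' => exact cross i j i' j' hs ht hps hpt
  | horiz i j =>
    cases t with
    | vert i' j' => exact (cross i' j' i j ht hs hpt hps).symm
    | horiz i' j' =>
      simp only [mem_seg_horiz] at hps hpt
      simp only [InPattern, ZMod.intCast_eq_intCast_iff, Int.ModEq] at hs ht
      have hj : j = j' := by exact_mod_cast hps.1.symm.trans hpt.1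
      have h1 : (i : ℝ) ≤ i' + 1 := hps.2.1.trans hpt.2.2
      have h2 : (i' : ℝ) ≤ i + 1 := hpt.2.1.trans hps.2.2
      norm_cast at h1 h2
      subst hj
      rw [show i = i' by omega]

end Stitch

open Stitch

theorem mem_curveOf {S : Set Stitch} {p : ℝ × ℝ} : p ∈ curveOf S ↔ ∃ s ∈ S, p ∈ s.seg := by
  simp [curveOf]

/-- A function on a finite set of stitches with connected union that agrees on intersecting
stitches is constant. -/
theorem eq_of_isPreconnected_curveOf {α : Type*} {S : Finset Stitch}
    (hS : IsPreconnected (curveOf (S : Set Stitch))) {g : Stitch → α}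
    (hg : ∀ s ∈ S, ∀ t ∈ S, ∀ p, p ∈ s.seg → p ∈ t.seg → g s = g t)
    {s t : Stitch} (hs : s ∈ S) (ht : t ∈ S) : g s = g t := by
  have hne : ∀ s : Stitch, s.seg.Nonempty := by
    rintro (⟨i, j⟩ | ⟨i, j⟩)
    exacts [⟨_, left_mem_segment ℝ _ _⟩, ⟨_, left_mem_segment ℝ _ _⟩]
  have hclosed : ∀ P : Set Stitch, IsClosed (curveOf ((S : Set Stitch) ∩ P)) := fun P =>
    (S.finite_toSet.inter_of_left P).isClosed_biUnion fun s _ => s.isClosed_seg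
  by_contra hst
  obtain ⟨p, hp⟩ := hne s
  obtain ⟨q, hq⟩ := hne t
  obtain ⟨z, -, hz₁, hz₂⟩ := isPreconnected_closed_iff.1 hS _ _ (hclosed {r | g r = g s})
    (hclosed {r | g r ≠ g s})
    (fun z hz => by
      obtain ⟨r, hr, hzr⟩ := mem_curveOf.1 hz
      by_cases h : g r = g s
      · exact Or.inl (mem_curveOf.2 ⟨r, ⟨hr, h⟩, hzr⟩)
      · exact Or.inr (mem_curveOf.2 ⟨r, ⟨hr, h⟩, hzr⟩))
    ⟨p, mem_curveOf.2 ⟨s, hs, hp⟩, mem_curveOf.2 ⟨s, ⟨hs, rfl⟩, hp⟩⟩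
    ⟨q, mem_curveOf.2 ⟨t, ht, hq⟩, mem_curveOf.2 ⟨t, ⟨ht, Ne.symm hst⟩, hq⟩⟩
  obtain ⟨r₁, ⟨hr₁, hgr₁⟩, hzr₁⟩ := mem_curveOf.1 hz₁
  obtain ⟨r₂, ⟨hr₂, hgr₂⟩, hzr₂⟩ := mem_curveOf.1 hz₂
  exact hgr₂ ((hg r₂ hr₂ r₁ hr₁ z hzr₂ hzr₁).trans hgr₁)

theorem exists_forall_succ_eq_add (u : ℤ → ℤ) : ∃ X : ℤ → ℤ, ∀ k, X (k + 1) = X k + u k := by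
  refine ⟨fun k => ∑ i ∈ Finset.range k.toNat, u i
    - ∑ i ∈ Finset.range (-k).toNat, u (-(i + 1)), fun k => ?_⟩
  rcases le_or_gt 0 k with hk | hk
  · have h1 : (k + 1).toNat = k.toNat + 1 := by omega
    have h2 : (-(k + 1)).toNat = 0 := by omega
    have h3 : (-k).toNat = 0 := by omega
    have h4 : (k.toNat : ℤ) = k := by omega
    simp only [h1, h2, h3, Finset.sum_range_succ, Finset.sum_range_zero, h4]
    ring
  · have h1 : (k + 1).toNat = 0 := by omega
    have h2 : k.toNat = 0 := by omega
    have h3 : (-k).toNat = (-(k + 1)).toNat + 1 := by omega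
    have h4 : -(((-(k + 1)).toNat : ℤ) + 1) = k := by omega
    simp only [h1, h2, h3, Finset.sum_range_succ, Finset.sum_range_zero, h4]
    ring

/-- A `±1` walk on `[a - 1/2, b + 1/2]` whose linear interpolation on `[a, b]` has its minimum,
half an odd integer `m`, at two distinct integer points: these are the endpoints. -/
theorem odd_sub_of_two_minima {X : ℤ → ℤ} (hX : ∀ k, X (k + 1) = X k + 1 ∨ X (k + 1) = X k - 1)
    {a b m i₁ i₂ : ℤ} (hm : ∀ k, a ≤ k → k < b → m ≤ 2 * X (k + 1)) (hne : i₁ ≠ i₂)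
    (ha₁ : a ≤ i₁) (hb₁ : i₁ ≤ b) (ha₂ : a ≤ i₂) (hb₂ : i₂ ≤ b)
    (hm₁ : X i₁ + X (i₁ + 1) = m) (hm₂ : X i₂ + X (i₂ + 1) = m) :
    X (a + 1) = X a + 1 ∧ Odd (b - a) := by
  have key : ∀ i, a ≤ i → i ≤ b → X i + X (i + 1) = m → i = a ∨ i = b := by
    intro i ha hb him
    by_contra! h
    have h1 := hm i ha (by omega)
    have h2 := hm (i - 1) (by omega) (by omega)
    rw [sub_add_cancel] at h2
    rcases hX i with h3 | h3 <;> omega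
  have hends : a < b ∧ X a + X (a + 1) = m ∧ X b + X (b + 1) = m := by
    rcases key i₁ ha₁ hb₁ hm₁ with rfl | rfl <;> rcases key i₂ ha₂ hb₂ hm₂ with rfl | rfl
    · exact absurd rfl hne
    · exact ⟨by omega, hm₁, hm₂⟩
    · exact ⟨by omega, hm₂, hm₁⟩
    · exact absurd rfl hne
  obtain ⟨hab, hma, hmb⟩ := hends
  have h1 := hm a le_rfl hab
  have h2 := hm (b - 1) (by omega) (by omega)
  rw [sub_add_cancel] at h2
  have hparity : ∀ k, a ≤ k → (X k - X a) % 2 = (k - a) % 2 := by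
    intro k hk
    induction k, hk using Int.leInduction with
    | base => simp
    | succ k _ ih => rcases hX k with h | h <;> omega
  have h3 := hparity b hab.le
  rw [Int.odd_iff]
  rcases hX a with h4 | h4 <;> rcases hX b with h5 | h5 <;> constructor <;> omega

/-- The dichotomy behind the parity statement: the minimum of `X` along a set of stitches of
constant level is attained either on the two extreme columns or on the two extreme rows. -/
theorem odd_sub_or_odd_sub_of_level_eq {X Y : ℤ → ℤ}
    (hX : ∀ k, X (k + 1) = X k + 1 ∨ X (k + 1) = X k - 1)
    (hY : ∀ k, Y (k + 1) = Y k + 1 ∨ Y (k + 1) = Y k - 1)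
    {S : Finset Stitch} (hS : S.Nonempty) {l : ℤ} (hl : ∀ s ∈ S, s.level X Y = l)
    {a b c d : ℤ}
    (hvert : ∀ i j, vert i j ∈ S → a ≤ i ∧ i ≤ b ∧ c ≤ j ∧ j < d)
    (hhoriz : ∀ i j, horiz i j ∈ S → a ≤ i ∧ i < b ∧ c ≤ j ∧ j ≤ d)
    (hrow : ∀ k, c ≤ k → k < d → ∃ i₁ i₂, i₁ ≠ i₂ ∧ vert i₁ k ∈ S ∧ vert i₂ k ∈ S)
    (hcol : ∀ k, a ≤ k → k < b → ∃ j₁ j₂, j₁ ≠ j₂ ∧ horiz k j₁ ∈ S ∧ horiz k j₂ ∈ S) :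
    (X (a + 1) = X a + 1 ∧ Odd (b - a)) ∨ (Y (c + 1) = Y c + 1 ∧ Odd (d - c)) := by
  obtain ⟨s, hs, hmin⟩ := S.exists_min_image (level X 0) hS
  have hcol' : ∀ k, a ≤ k → k < b → s.level X 0 ≤ 2 * X (k + 1) := by
    intro k h1 h2
    obtain ⟨j, -, -, hj, -⟩ := hcol k h1 h2
    simpa [level] using hmin _ hj
  have hrow' : ∀ k, c ≤ k → k < d → s.level X 0 - l ≤ 2 * Y (k + 1) := by
    intro k h1 h2
    obtain ⟨i, -, -, hi, -⟩ := hrow k h1 h2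
    have h3 := hmin _ hi
    have h4 := hl _ hi
    simp only [level, Pi.zero_apply] at h3 h4 ⊢
    omega
  have hls := hl s hs
  cases s with
  | vert i j =>
    left
    obtain ⟨-, -, h1, h2⟩ := hvert i j hs
    obtain ⟨i₁, i₂, hne, hi₁, hi₂⟩ := hrow j h1 h2
    obtain ⟨ha₁, hb₁, -⟩ := hvert _ _ hi₁
    obtain ⟨ha₂, hb₂, -⟩ := hvert _ _ hi₂
    have hl₁ := hl _ hi₁
    have hl₂ := hl _ hi₂
    refine odd_sub_of_two_minima hX hcol' hne ha₁ hb₁ ha₂ hb₂ ?_ ?_ <;>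
      simp only [level, Pi.zero_apply] at * <;> omega
  | horiz i j =>
    right
    obtain ⟨h1, h2, -⟩ := hhoriz i j hs
    obtain ⟨j₁, j₂, hne, hj₁, hj₂⟩ := hcol i h1 h2
    obtain ⟨-, -, hc₁, hd₁⟩ := hhoriz _ _ hj₁
    obtain ⟨-, -, hc₂, hd₂⟩ := hhoriz _ _ hj₂
    have hl₁ := hl _ hj₁
    have hl₂ := hl _ hj₂
    refine odd_sub_of_two_minima hY hrow' hne hc₁ hd₁ hc₂ hd₂ ?_ ?_ <;>
      simp only [level, Pi.zero_apply] at * <;> omega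

/-- If `f` has integer extrema on each stitch of a nonempty finite set, then it has integer
extrema on their union. -/
theorem exists_isLeast_isGreatest_image_curveOf {S : Finset Stitch} (hS : S.Nonempty)
    {f : ℝ × ℝ → ℝ} {lo hi : Stitch → ℤ} (hlo : ∀ s, IsLeast (f '' s.seg) (lo s))
    (hhi : ∀ s, IsGreatest (f '' s.seg) (hi s)) :
    ∃ a b : ℤ, IsLeast (f '' curveOf (S : Set Stitch)) (a : ℝ) ∧
      IsGreatest (f '' curveOf (S : Set Stitch)) (b : ℝ) := by
  obtain ⟨s, hs, hsmin⟩ := S.exists_min_image lo hS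
  obtain ⟨t, ht, htmax⟩ := S.exists_max_image hi hS
  have hsub : ∀ r ∈ S, f '' r.seg ⊆ f '' curveOf (S : Set Stitch) := fun r hr =>
    Set.image_mono fun p hp => mem_curveOf.2 ⟨r, hr, hp⟩
  refine ⟨lo s, hi t, ⟨hsub s hs (hlo s).1, ?_⟩, ⟨hsub t ht (hhi t).1, ?_⟩⟩
  · rintro _ ⟨p, hp, rfl⟩
    obtain ⟨r, hr, hpr⟩ := mem_curveOf.1 hp
    exact (Int.cast_le.2 (hsmin r hr)).trans ((hlo r).2 ⟨p, hpr, rfl⟩)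
  · rintro _ ⟨p, hp, rfl⟩
    obtain ⟨r, hr, hpr⟩ := mem_curveOf.1 hp
    exact ((hhi r).2 ⟨p, hpr, rfl⟩).trans (Int.cast_le.2 (htmax r hr))

namespace HLoop

variable {ε η : ℤ → ZMod 2} (L : HLoop ε η)

theorem stitches_nonempty : L.stitches.Nonempty := by
  obtain ⟨p, hp⟩ := L.isCircle.nonempty
  obtain ⟨s, hs, -⟩ := mem_curveOf.1 hp
  exact ⟨s, hs⟩

theorem exists_isLeast_isGreatest_fst : ∃ a b : ℤ,
    IsLeast (Prod.fst '' curveOf (L.stitches : Set Stitch)) (a : ℝ) ∧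
    IsGreatest (Prod.fst '' curveOf (L.stitches : Set Stitch)) (b : ℝ) := by
  refine exists_isLeast_isGreatest_image_curveOf L.stitches_nonempty
    (lo := fun | .vert i _ => i | .horiz i _ => i)
    (hi := fun | .vert i _ => i | .horiz i _ => i + 1) ?_ ?_
  · rintro (⟨i, j⟩ | ⟨i, j⟩)
    · refine ⟨⟨(i, j), by simp [mem_seg_vert], rfl⟩, ?_⟩
      rintro _ ⟨p, hp, rfl⟩
      exact (mem_seg_vert.1 hp).1.ge
    · refine ⟨⟨(i, j), by simp [mem_seg_horiz], rfl⟩, ?_⟩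
      rintro _ ⟨p, hp, rfl⟩
      exact (mem_seg_horiz.1 hp).2.1
  · rintro (⟨i, j⟩ | ⟨i, j⟩)
    · refine ⟨⟨(i, j), by simp [mem_seg_vert], rfl⟩, ?_⟩
      rintro _ ⟨p, hp, rfl⟩
      exact (mem_seg_vert.1 hp).1.le
    · refine ⟨⟨((i : ℝ) + 1, j), by simp [mem_seg_horiz], by simp⟩, ?_⟩
      rintro _ ⟨p, hp, rfl⟩
      simpa using (mem_seg_horiz.1 hp).2.2

theorem exists_isLeast_isGreatest_snd : ∃ c d : ℤ,
    IsLeast (Prod.snd '' curveOf (L.stitches : Set Stitch)) (c : ℝ) ∧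
    IsGreatest (Prod.snd '' curveOf (L.stitches : Set Stitch)) (d : ℝ) := by
  refine exists_isLeast_isGreatest_image_curveOf L.stitches_nonempty
    (lo := fun | .vert _ j => j | .horiz _ j => j)
    (hi := fun | .vert _ j => j + 1 | .horiz _ j => j) ?_ ?_
  · rintro (⟨i, j⟩ | ⟨i, j⟩)
    · refine ⟨⟨(i, j), by simp [mem_seg_vert], rfl⟩, ?_⟩
      rintro _ ⟨p, hp, rfl⟩
      exact (mem_seg_vert.1 hp).2.1
    · refine ⟨⟨(i, j), by simp [mem_seg_horiz], rfl⟩, ?_⟩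
      rintro _ ⟨p, hp, rfl⟩
      exact (mem_seg_horiz.1 hp).1.ge
  · rintro (⟨i, j⟩ | ⟨i, j⟩)
    · refine ⟨⟨(i, (j : ℝ) + 1), by simp [mem_seg_vert], by simp⟩, ?_⟩
      rintro _ ⟨p, hp, rfl⟩
      simpa using (mem_seg_vert.1 hp).2.2
    · refine ⟨⟨(i, j), by simp [mem_seg_horiz], rfl⟩, ?_⟩
      rintro _ ⟨p, hp, rfl⟩
      exact (mem_seg_horiz.1 hp).1.le

/-- A loop with points on both sides of a column has two horizontal stitches in it. -/
theorem exists_horiz_ne {p₁ p₂ : ℝ × ℝ} (h₁ : p₁ ∈ curveOf (L.stitches : Set Stitch))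
    (h₂ : p₂ ∈ curveOf (L.stitches : Set Stitch)) {k : ℤ} (hk₁ : p₁.1 ≤ k) (hk₂ : k + 1 ≤ p₂.1) :
    ∃ j₁ j₂, j₁ ≠ j₂ ∧ horiz k j₁ ∈ L.stitches ∧ horiz k j₂ ∈ L.stitches := by
  have key : ∀ q ∈ curveOf (L.stitches : Set Stitch), q.1 = k + 1 / 2 →
      ∃ j : ℤ, horiz k j ∈ L.stitches ∧ q.2 = j := by
    intro q hq hqk
    obtain ⟨⟨i, j⟩ | ⟨i, j⟩, hs, hqs⟩ := mem_curveOf.1 hq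
    · have h1 : (2 * i : ℝ) = 2 * k + 1 := by linarith [(mem_seg_vert.1 hqs).1]
      norm_cast at h1
      omega
    · obtain ⟨h1, h2, h3⟩ := mem_seg_horiz.1 hqs
      have h4 : (2 * i : ℝ) ≤ 2 * k + 1 := by linarith
      have h5 : (2 * k + 1 : ℝ) ≤ 2 * i + 2 := by linarith
      norm_cast at h4 h5
      obtain rfl : i = k := by omega
      exact ⟨j, hs, h1⟩
  obtain ⟨q₁, hq₁, q₂, hq₂, hne, hf₁, hf₂⟩ := L.isCircle.exists_ne_eq_level continuous_fst h₁ h₂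
    (t := k + 1 / 2) (by linarith) (by linarith)
  obtain ⟨j₁, hj₁, hy₁⟩ := key q₁ hq₁ hf₁
  obtain ⟨j₂, hj₂, hy₂⟩ := key q₂ hq₂ hf₂
  refine ⟨j₁, j₂, ?_, hj₁, hj₂⟩
  rintro rfl
  exact hne (Prod.ext (hf₁.trans hf₂.symm) (hy₁.trans hy₂.symm))

/-- A loop with points on both sides of a row has two vertical stitches in it. -/
theorem exists_vert_ne {p₁ p₂ : ℝ × ℝ} (h₁ : p₁ ∈ curveOf (L.stitches : Set Stitch))
    (h₂ : p₂ ∈ curveOf (L.stitches : Set Stitch)) {k : ℤ} (hk₁ : p₁.2 ≤ k) (hk₂ : k + 1 ≤ p₂.2) :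
    ∃ i₁ i₂, i₁ ≠ i₂ ∧ vert i₁ k ∈ L.stitches ∧ vert i₂ k ∈ L.stitches := by
  have key : ∀ q ∈ curveOf (L.stitches : Set Stitch), q.2 = k + 1 / 2 →
      ∃ i : ℤ, vert i k ∈ L.stitches ∧ q.1 = i := by
    intro q hq hqk
    obtain ⟨⟨i, j⟩ | ⟨i, j⟩, hs, hqs⟩ := mem_curveOf.1 hq
    · obtain ⟨h1, h2, h3⟩ := mem_seg_vert.1 hqs
      have h4 : (2 * j : ℝ) ≤ 2 * k + 1 := by linarith
      have h5 : (2 * k + 1 : ℝ) ≤ 2 * j + 2 := by linarith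
      norm_cast at h4 h5
      obtain rfl : j = k := by omega
      exact ⟨i, hs, h1⟩
    · have h1 : (2 * j : ℝ) = 2 * k + 1 := by linarith [(mem_seg_horiz.1 hqs).1]
      norm_cast at h1
      omega
  obtain ⟨q₁, hq₁, q₂, hq₂, hne, hf₁, hf₂⟩ := L.isCircle.exists_ne_eq_level continuous_snd h₁ h₂
    (t := k + 1 / 2) (by linarith) (by linarith)
  obtain ⟨i₁, hi₁, hx₁⟩ := key q₁ hq₁ hf₁
  obtain ⟨i₂, hi₂, hx₂⟩ := key q₂ hq₂ hf₂
  refine ⟨i₁, i₂, ?_, hi₁, hi₂⟩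
  rintro rfl
  exact hne (Prod.ext (hx₁.trans hx₂.symm) (hf₁.trans hf₂.symm))

end HLoop

/-- Every hitomezashi loop has odd width and odd height. -/
theorem hitomezashi_loop_odd_width_height (ε η : ℤ → ZMod 2) (L : HLoop ε η) :
    (∃ w : ℤ, Odd w ∧ loopWidth L = (w : ℝ)) ∧
    (∃ h : ℤ, Odd h ∧ loopHeight L = (h : ℝ)) := by
  obtain ⟨ε, rfl⟩ : ∃ e : ℤ → ℤ, ε = fun i => (e i : ZMod 2) :=
    ⟨fun i => (ε i).cast, by simp⟩
  obtain ⟨η, rfl⟩ : ∃ e : ℤ → ℤ, η = fun i => (e i : ZMod 2) :=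
    ⟨fun i => (η i).cast, by simp⟩
  obtain ⟨X, hX⟩ := exists_forall_succ_eq_add fun i => if Odd (i + ε i) then 1 else -1
  obtain ⟨Y, hY⟩ := exists_forall_succ_eq_add fun j => if Even (j + η j) then 1 else -1
  obtain ⟨a, b, ha, hb⟩ := L.exists_isLeast_isGreatest_fst
  obtain ⟨c, d, hc, hd⟩ := L.exists_isLeast_isGreatest_snd
  have hX' : ∀ k, X (k + 1) = X k + 1 ∨ X (k + 1) = X k - 1 := by
    intro k
    rw [hX]
    split_ifs <;> simp [sub_eq_add_neg]
  have hY' : ∀ k, Y (k + 1) = Y k + 1 ∨ Y (k + 1) = Y k - 1 := by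
    intro k
    rw [hY]
    split_ifs <;> simp [sub_eq_add_neg]
  obtain ⟨s₀, hs₀⟩ := L.stitches_nonempty
  have hl : ∀ s ∈ L.stitches, s.level X Y = s₀.level X Y := fun s hs =>
    eq_of_isPreconnected_curveOf L.isCircle.isPreconnected (fun s hs t ht p hps hpt =>
      level_eq_of_mem_seg hX hY (L.inPattern s hs) (L.inPattern t ht) hps hpt) hs hs₀
  have hmem : ∀ s ∈ L.stitches, ∀ p ∈ s.seg,
      (a : ℝ) ≤ p.1 ∧ p.1 ≤ b ∧ (c : ℝ) ≤ p.2 ∧ p.2 ≤ d := by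
    intro s hs p hp
    have h := mem_curveOf.2 ⟨s, hs, hp⟩
    exact ⟨ha.2 ⟨p, h, rfl⟩, hb.2 ⟨p, h, rfl⟩, hc.2 ⟨p, h, rfl⟩, hd.2 ⟨p, h, rfl⟩⟩
  have hvert : ∀ i j, vert i j ∈ L.stitches → a ≤ i ∧ i ≤ b ∧ c ≤ j ∧ j < d := by
    intro i j h
    have h1 := hmem _ h (i, j) (by simp [mem_seg_vert])
    have h2 := hmem _ h (i, (j : ℝ) + 1) (by simp [mem_seg_vert])
    dsimp only at h1 h2
    norm_cast at h1 h2
    omega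
  have hhoriz : ∀ i j, horiz i j ∈ L.stitches → a ≤ i ∧ i < b ∧ c ≤ j ∧ j ≤ d := by
    intro i j h
    have h1 := hmem _ h (i, j) (by simp [mem_seg_horiz])
    have h2 := hmem _ h ((i : ℝ) + 1, j) (by simp [mem_seg_horiz])
    dsimp only at h1 h2
    norm_cast at h1 h2
    omega
  have hcol : ∀ k, a ≤ k → k < b →
      ∃ j₁ j₂, j₁ ≠ j₂ ∧ horiz k j₁ ∈ L.stitches ∧ horiz k j₂ ∈ L.stitches := by
    intro k hak hkb
    obtain ⟨p, hp, hpa⟩ := ha.1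
    obtain ⟨q, hq, hqb⟩ := hb.1
    exact L.exists_horiz_ne hp hq (hpa.trans_le (by exact_mod_cast hak))
      (le_trans (by exact_mod_cast hkb) hqb.ge)
  have hrow : ∀ k, c ≤ k → k < d →
      ∃ i₁ i₂, i₁ ≠ i₂ ∧ vert i₁ k ∈ L.stitches ∧ vert i₂ k ∈ L.stitches := by
    intro k hck hkd
    obtain ⟨p, hp, hpc⟩ := hc.1
    obtain ⟨q, hq, hqd⟩ := hd.1
    exact L.exists_vert_ne hp hq (hpc.trans_le (by exact_mod_cast hck))
      (le_trans (by exact_mod_cast hkd) hqd.ge)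
  have hmin := odd_sub_or_odd_sub_of_level_eq hX' hY' ⟨s₀, hs₀⟩ hl hvert hhoriz hrow hcol
  have hmax := odd_sub_or_odd_sub_of_level_eq (X := -X) (Y := -Y) (l := -s₀.level X Y)
    (fun k => by have := hX' k; simp only [Pi.neg_apply]; omega)
    (fun k => by have := hY' k; simp only [Pi.neg_apply]; omega) ⟨s₀, hs₀⟩
    (fun s hs => by
      rw [← hl s hs]
      cases s <;> simp only [level, Pi.neg_apply] <;> ring)
    hvert hhoriz hrow hcol
  simp only [Pi.neg_apply] at hmax
  have hodd : Odd (b - a) ∧ Odd (d - c) := by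
    rcases hmin with ⟨h1, h2⟩ | ⟨h1, h2⟩ <;> rcases hmax with ⟨h3, h4⟩ | ⟨h3, h4⟩
    · omega
    · exact ⟨h2, h4⟩
    · exact ⟨h4, h2⟩
    · omega
  refine ⟨⟨b - a, hodd.1, ?_⟩, ⟨d - c, hodd.2, ?_⟩⟩
  · rw [loopWidth, hb.csSup_eq, ha.csInf_eq, Int.cast_sub]
  · rw [loopHeight, hd.csSup_eq, hc.csInf_eq, Int.cast_sub]
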